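/- arXiv:1004.2973 — 2 statements merged into one kernel-verified Lean document; each statement's English description precedes it below -/
import Mathlib

section
/- Let n ≥ 3 be an integer and let s be a real number that is not an integer, with 1 < s < n/2, and set m = ⌊s⌋ (so m < s < m+1). Assume that one of the following holds: (a) s ≥ 2, or (b) s < 2n/(n+1), or (c) n is even. Then n·m > s·⌈n/2⌉. -/
/-- For an integer `n ≥ 3` and a non-integer real `s` with `1 < s < n/2`, `m = ⌊s⌋`,
assuming `s ≥ 2`, or `s < 2n/(n+1)`, or `n` even, one has `n·m > s·⌈n/2⌉`. -/
theorem key_arithmetic_inequality (n : ℕ) (hn : 3 ≤ n) (s : ℝ)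
    (hs_nonint : ∀ k : ℤ, s ≠ (k : ℝ)) (hs1 : 1 < s) (hs2 : s < (n : ℝ) / 2)
    (hcase : 2 ≤ s ∨ s < 2 * (n : ℝ) / ((n : ℝ) + 1) ∨ Even n) :
    (n : ℝ) * ((⌊s⌋ : ℤ) : ℝ) > s * ((⌈(n : ℝ) / 2⌉ : ℤ) : ℝ) := by
  have hn' : (3 : ℝ) ≤ n := by exact_mod_cast hn
  have hm1 : (1 : ℤ) ≤ ⌊s⌋ := Int.le_floor.2 (by push_cast; linarith)
  have hm1' : (1 : ℝ) ≤ (⌊s⌋ : ℤ) := by exact_mod_cast hm1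
  have hlt : s < (⌊s⌋ : ℤ) + 1 := Int.lt_floor_add_one s
  have hs0 : 0 < s := by linarith
  rcases Nat.even_or_odd' n with ⟨k, hk | hk⟩
  · have hc : ⌈(n : ℝ) / 2⌉ ≤ (k : ℤ) := Int.ceil_le.2 (by rw [hk]; push_cast; linarith)
    have hc' : ((⌈(n : ℝ) / 2⌉ : ℤ) : ℝ) ≤ k := by exact_mod_cast hc
    have hkr : (n : ℝ) = 2 * k := by exact_mod_cast hk
    have h1 := mul_le_mul_of_nonneg_left hc' hs0.le
    have hk0 : (0 : ℝ) < k := by linarith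
    have h2 : s < 2 * (⌊s⌋ : ℤ) := by linarith
    have h3 := mul_lt_mul_of_pos_right h2 hk0
    have h4 : (n : ℝ) * (⌊s⌋ : ℤ) = 2 * (⌊s⌋ : ℤ) * k := by rw [hkr]; ring
    linarith
  · have hkr : (n : ℝ) = 2 * k + 1 := by exact_mod_cast hk
    have hc : ⌈(n : ℝ) / 2⌉ ≤ (k : ℤ) + 1 := Int.ceil_le.2 (by push_cast; linarith)
    have hc' : ((⌈(n : ℝ) / 2⌉ : ℤ) : ℝ) ≤ ((n : ℝ) + 1) / 2 := by
      have : ((⌈(n : ℝ) / 2⌉ : ℤ) : ℝ) ≤ k + 1 := by exact_mod_cast hc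
      linarith
    have h1 := mul_le_mul_of_nonneg_left hc' hs0.le
    suffices h : s * ((n : ℝ) + 1) < 2 * (n * (⌊s⌋ : ℤ)) by linarith
    rcases hcase with h | h | h
    · have hm2 : (2 : ℤ) ≤ ⌊s⌋ := Int.le_floor.2 (by push_cast; linarith)
      have hm2' : (2 : ℝ) ≤ (⌊s⌋ : ℤ) := by exact_mod_cast hm2
      have h3 := mul_lt_mul_of_pos_right hlt (by linarith : (0 : ℝ) < n + 1)
      nlinarith [mul_nonneg (sub_nonneg.2 hn') (sub_nonneg.2 hm2')]
    · rw [lt_div_iff₀ (by linarith)] at h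
      nlinarith
    · obtain ⟨j, hj⟩ := h
      omega
end

section
/- Let n ≥ 3 be an integer and let s be a real number that is not an integer, with 1 < s < n/2, and set m = ⌊s⌋ (so m < s < m+1) and d = ⌊n/2⌋. Assume that one of the following holds: (a) s ≥ 2, or (b) s < 2n/(n+1), or (c) n is even. Assume moreover that n − d − 2m > 0. Then the critical exponent q = 2n/(n−2s) satisfies q < 2(n−d)/(n−d−2m). -/
/-- For an integer `n ≥ 3`, a non-integer real `s` with `1 < s < n/2`, `m = ⌊s⌋`,
`d = ⌊n/2⌋`, assuming `s ≥ 2`, or `s < 2n/(n+1)`, or `n` even, and `n - d - 2m > 0`,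
the critical exponent `q = 2n/(n-2s)` satisfies `q < 2(n-d)/(n-d-2m)`. -/
theorem critical_exponent_subcritical (n : ℕ) (hn : 3 ≤ n) (s : ℝ)
    (hs_nonint : ∀ k : ℤ, s ≠ (k : ℝ)) (hs1 : 1 < s) (hs2 : s < (n : ℝ) / 2)
    (m : ℤ) (hm : m = ⌊s⌋) (d : ℕ) (hd : d = n / 2)
    (hcase : 2 ≤ s ∨ s < 2 * (n : ℝ) / ((n : ℝ) + 1) ∨ Even n)
    (hpos : 0 < (n : ℝ) - (d : ℝ) - 2 * (m : ℝ))
    (q : ℝ) (hq : q = 2 * (n : ℝ) / ((n : ℝ) - 2 * s)) :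
    q < 2 * ((n : ℝ) - (d : ℝ)) / ((n : ℝ) - (d : ℝ) - 2 * (m : ℝ)) := by
  have hm1 : (m : ℝ) ≤ s := by rw [hm]; exact Int.floor_le s
  have hm2 : s < (m : ℝ) + 1 := by rw [hm]; exact Int.lt_floor_add_one s
  have hm0 : (1 : ℤ) ≤ m := by rw [hm]; exact Int.le_floor.mpr (by push_cast; exact hs1.le)
  have hm0' : (1 : ℝ) ≤ m := by exact_mod_cast hm0
  have hn' : (3 : ℝ) ≤ n := by exact_mod_cast hn
  have key : s * ((n : ℝ) - d) < m * n := by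
    rcases Nat.even_or_odd' n with ⟨k, hk | hk⟩
    · have hdk : d = k := by omega
      subst hdk
      have hnk : (n : ℝ) = 2 * d := by rw [hk]; push_cast; ring
      have hd0 : (0 : ℝ) < d := by linarith
      rw [hnk]
      nlinarith
    · have hdk : d = k := by omega
      subst hdk
      have hnk : (n : ℝ) = 2 * d + 1 := by rw [hk]; push_cast; ring
      have hd0 : (1 : ℝ) ≤ d := by linarith
      by_cases h2 : 2 ≤ s
      · have hm3 : (2 : ℤ) ≤ m := by rw [hm]; exact Int.le_floor.mpr (by push_cast; exact h2)
        have hm3' : (2 : ℝ) ≤ m := by exact_mod_cast hm3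
        have h1 : s * ((d : ℝ) + 1) < (m + 1) * (d + 1) :=
          mul_lt_mul_of_pos_right hm2 (by linarith)
        have h3 : 0 ≤ ((m : ℝ) - 2) * d := mul_nonneg (by linarith) (by linarith)
        rw [hnk]
        nlinarith
      · have hodd : ¬ Even n := by
          rw [Nat.not_even_iff_odd]; exact ⟨d, hk⟩
        have hb : s < 2 * (n : ℝ) / ((n : ℝ) + 1) := by tauto
        rw [lt_div_iff₀ (by linarith)] at hb
        rw [hnk] at hb ⊢
        nlinarith
  rw [hq, div_lt_div_iff₀ (by linarith) hpos]
  nlinarith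
end
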